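/- arXiv:math/0703746 — 6 statements merged into one kernel-verified Lean document; each statement's English description precedes it below -/
import Mathlib

section
/- Let K ≥ 3 be a natural number and y : Fin K → ℝ data whose sample variance is positive, i.e. S := ∑_j (y_j − ȳ)² > 0 where ȳ = (1/K) ∑_j y_j. Then the unnormalized posterior density f(μ, λ) = λ^{−(K+1)/2} · exp(−(1/(2λ)) ∑_j (y_j − μ)²) is integrable over (μ, λ) ∈ ℝ × (0, ∞), and its integral is strictly positive; that is, the posterior distribution is proper whenever K ≥ 3. -/
open MeasureTheory Real Set

/-- The unnormalized inverse-gamma density is integrable on `(0, ∞)`. -/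
lemma integrableOn_rpow_neg_mul_exp_neg_div {a b : ℝ} (ha : 1 < a) (hb : 0 < b) :
    IntegrableOn (fun x : ℝ => x ^ (-a) * exp (-(b / x))) (Ioi 0) := by
  have h := integrableOn_rpow_mul_exp_neg_mul_rpow (p := 1) (s := a - 2) (b := b)
    (by linarith) one_pos hb
  rw [← integrableOn_Ioi_comp_rpow_iff' _ (show (-1 : ℝ) ≠ 0 by norm_num)] at h
  refine h.congr_fun (fun x (hx : 0 < x) => ?_) measurableSet_Ioi
  simp only [smul_eq_mul, rpow_one]
  rw [← rpow_mul hx.le, ← mul_assoc, ← rpow_add hx, rpow_neg_one]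
  ring_nf

/-- Decomposition of a sum of squares about an arbitrary point into the part centered at the
sample mean and the squared distance to the mean. -/
lemma sum_sub_sq_eq_sum_sub_mean_sq_add {K : ℕ} (hK : K ≠ 0) (y : Fin K → ℝ) (m : ℝ) :
    ∑ j, (y j - m) ^ 2 =
      ∑ j, (y j - 1 / (K : ℝ) * ∑ i, y i) ^ 2 + K * (m - 1 / (K : ℝ) * ∑ i, y i) ^ 2 := by
  have hK' : (K : ℝ) ≠ 0 := Nat.cast_ne_zero.mpr hK
  simp only [sub_sq, Finset.sum_add_distrib, Finset.sum_sub_distrib, Finset.sum_const,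
    Finset.card_univ, Fintype.card_fin, nsmul_eq_mul, ← Finset.sum_mul, ← Finset.mul_sum]
  field_simp
  ring

/-- The unnormalized normal-inverse-gamma density is integrable on `ℝ × (0, ∞)`. -/
lemma integrableOn_rpow_mul_exp_neg_mul_add_sq {k s : ℝ} (hk : 2 < k) (hs : 0 < s) (c : ℝ) :
    IntegrableOn (fun p : ℝ × ℝ => p.2 ^ (-((k + 1) / 2)) *
      exp (-(1 / (2 * p.2)) * (s + k * (p.1 - c) ^ 2))) (univ ×ˢ Ioi 0) := by
  have hsplit : ∀ m l : ℝ, l ^ (-((k + 1) / 2)) * exp (-(1 / (2 * l)) * (s + k * (m - c) ^ 2)) =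
      l ^ (-((k + 1) / 2)) * exp (-(s / 2 / l)) * exp (-(k / (2 * l)) * (m - c) ^ 2) := by
    intro m l
    rw [mul_assoc, ← exp_add]
    ring_nf
  rw [IntegrableOn, Measure.volume_eq_prod, ← Measure.prod_restrict, Measure.restrict_univ,
    integrable_prod_iff' (by measurability)]
  simp only [hsplit]
  constructor
  · filter_upwards [ae_restrict_mem measurableSet_Ioi] with l (hl : 0 < l)
    exact ((integrable_exp_neg_mul_sq (b := k / (2 * l)) (by positivity)).comp_sub_right
      c).const_mul _
  · have h := (integrableOn_rpow_neg_mul_exp_neg_div (a := k / 2) (b := s / 2) (by linarith)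
      (by positivity)).const_mul √(π * 2 / k)
    refine IntegrableOn.congr_fun h (fun l (hl : 0 < l) => ?_) measurableSet_Ioi
    have hnorm : ∀ m : ℝ, ‖l ^ (-((k + 1) / 2)) * exp (-(s / 2 / l)) *
        exp (-(k / (2 * l)) * (m - c) ^ 2)‖ = l ^ (-((k + 1) / 2)) * exp (-(s / 2 / l)) *
        exp (-(k / (2 * l)) * (m - c) ^ 2) := fun m => norm_of_nonneg (by positivity)
    have hpow : l ^ (-(k / 2)) = l ^ (-((k + 1) / 2)) * √l := by
      rw [sqrt_eq_rpow, ← rpow_add hl]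
      ring_nf
    simp only [hnorm]
    rw [integral_const_mul,
      integral_sub_right_eq_self (fun m : ℝ => exp (-(k / (2 * l)) * m ^ 2)) c,
      integral_gaussian, hpow, show π / (k / (2 * l)) = π * 2 / k * l by field_simp,
      sqrt_mul (by positivity)]
    ring

/-- For `K ≥ 3` and data `y` with positive centered sum of squares `S`,
the unnormalized posterior density
`f(μ, λ) = λ^{-(K+1)/2} exp(-(1/(2λ)) ∑ (y_j - μ)²)`
is integrable over `ℝ × (0, ∞)` and its integral is strictly positive:
the posterior is proper whenever `K ≥ 3`. -/
theorem posterior_proper_of_three_le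
    (K : ℕ) (hK : 3 ≤ K) (y : Fin K → ℝ)
    (ybar : ℝ) (hybar : ybar = (1 / (K : ℝ)) * ∑ j, y j)
    (S : ℝ) (hS : S = ∑ j, (y j - ybar) ^ 2) (hSpos : 0 < S)
    (f : ℝ → ℝ → ℝ)
    (hf : ∀ (μ l : ℝ),
      f μ l = l ^ (-(((K : ℝ) + 1) / 2)) *
        Real.exp (-(1 / (2 * l)) * ∑ j, (y j - μ) ^ 2)) :
    IntegrableOn (fun p : ℝ × ℝ => f p.1 p.2)
      ((Set.univ : Set ℝ) ×ˢ Set.Ioi (0 : ℝ)) ∧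
    0 < ∫ p in (Set.univ : Set ℝ) ×ˢ Set.Ioi (0 : ℝ), f p.1 p.2 := by
  have hsq : ∀ m : ℝ, ∑ j, (y j - m) ^ 2 = S + K * (m - ybar) ^ 2 := by
    intro m
    rw [hS, hybar]
    exact sum_sub_sq_eq_sum_sub_mean_sq_add (by omega) y m
  have hint : IntegrableOn (fun p : ℝ × ℝ => f p.1 p.2) (univ ×ˢ Ioi 0) := by
    simp only [hf, hsq]
    exact integrableOn_rpow_mul_exp_neg_mul_add_sq (by exact_mod_cast hK) hSpos ybar
  have hmeas : MeasurableSet ((univ : Set ℝ) ×ˢ Ioi (0 : ℝ)) :=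
    MeasurableSet.univ.prod measurableSet_Ioi
  have hpos : ∀ p ∈ (univ : Set ℝ) ×ˢ Ioi (0 : ℝ), 0 < f p.1 p.2 := by
    rintro p ⟨-, hp⟩
    rw [hf]
    exact mul_pos (rpow_pos_of_pos hp _) (exp_pos _)
  refine ⟨hint, (setIntegral_pos_iff_support_of_nonneg_ae ?_ hint).mpr ?_⟩
  · filter_upwards [ae_restrict_mem hmeas] with p hp using (hpos p hp).le
  · rw [inter_eq_self_of_subset_right fun p hp => Function.mem_support.mpr (hpos p hp).ne']
    exact (isOpen_univ.prod isOpen_Ioi).measure_pos _ ⟨(0, 1), by simp⟩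
end

section
/- Let K = 2 and let y : Fin 2 → ℝ with y_0 ≠ y_1. Then the unnormalized posterior density f(μ, λ) = λ^{−(K+1)/2} · exp(−(1/(2λ)) ∑_j (y_j − μ)²) is NOT integrable over (μ, λ) ∈ ℝ × (0, ∞); that is, the posterior is improper when K = 2. -/
open MeasureTheory Real Set

theorem integral_posterior_density_two (y : Fin 2 → ℝ) {l : ℝ} (hl : 0 < l) :
    ∫ μ : ℝ, l ^ (-(((2 : ℝ) + 1) / 2)) * Real.exp (-(1 / (2 * l)) * ∑ j, (y j - μ) ^ 2) =
      √π * Real.exp (-((y 0 - y 1) ^ 2 / 4) / l) * l⁻¹ := by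
  have complete_square : ∀ μ : ℝ,
      l ^ (-(((2 : ℝ) + 1) / 2)) * Real.exp (-(1 / (2 * l)) * ∑ j, (y j - μ) ^ 2) =
        l ^ (-(((2 : ℝ) + 1) / 2)) * Real.exp (-((y 0 - y 1) ^ 2 / 4) / l) *
          Real.exp (-l⁻¹ * (μ - (y 0 + y 1) / 2) ^ 2) := by
    intro μ
    rw [mul_assoc, ← Real.exp_add, Fin.sum_univ_two]
    congr 2
    field_simp
    ring
  have rpow_mul_sqrt : l ^ (-(((2 : ℝ) + 1) / 2)) * √l = l⁻¹ := by
    rw [Real.sqrt_eq_rpow, ← Real.rpow_add hl, ← Real.rpow_neg_one]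
    norm_num
  simp_rw [complete_square]
  rw [integral_const_mul, integral_sub_right_eq_self (fun x : ℝ => Real.exp (-l⁻¹ * x ^ 2)),
    integral_gaussian, div_inv_eq_mul, Real.sqrt_mul Real.pi_pos.le, ← rpow_mul_sqrt]
  ring

theorem not_integrableOn_Ioi_exp_neg_div_mul_inv {a c : ℝ} (ha : 0 ≤ a) (hc : 0 < c) :
    ¬ IntegrableOn (fun l : ℝ => c * Real.exp (-a / l) * l⁻¹) (Ioi 0) := by
  intro h
  refine not_integrableOn_Ioi_inv (a := 1) ?_
  refine ((h.mono_set (Ioi_subset_Ioi zero_le_one)).const_mul (c * Real.exp (-a))⁻¹).mono'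
    measurable_inv.aestronglyMeasurable ?_
  filter_upwards [ae_restrict_mem measurableSet_Ioi] with l (hl : 1 < l)
  have hl0 : 0 < l := zero_lt_one.trans hl
  have exp_le : Real.exp (-a) ≤ Real.exp (-a / l) := by
    rw [Real.exp_le_exp, neg_div, neg_le_neg_iff]
    exact div_le_self ha hl.le
  rw [Real.norm_of_nonneg (inv_nonneg.2 hl0.le), le_inv_mul_iff₀ (by positivity)]
  gcongr

/-- For `K = 2` and data `y` with `y 0 ≠ y 1`, the unnormalized
posterior density `f(μ, λ) = λ^{-(K+1)/2} exp(-(1/(2λ)) ∑ (y_j - μ)²)` is NOT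
integrable over `ℝ × (0, ∞)`: the posterior is improper when `K = 2`. -/
theorem posterior_improper_of_K_eq_two
    (y : Fin 2 → ℝ) (hy : y 0 ≠ y 1)
    (f : ℝ → ℝ → ℝ)
    (hf : ∀ (μ l : ℝ),
      f μ l = l ^ (-(((2 : ℝ) + 1) / 2)) *
        Real.exp (-(1 / (2 * l)) * ∑ j, (y j - μ) ^ 2)) :
    ¬ IntegrableOn (fun p : ℝ × ℝ => f p.1 p.2)
      ((Set.univ : Set ℝ) ×ˢ Set.Ioi (0 : ℝ)) := by
  intro h
  rw [IntegrableOn, Measure.volume_eq_prod, ← Measure.prod_restrict] at h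
  refine not_integrableOn_Ioi_exp_neg_div_mul_inv (a := (y 0 - y 1) ^ 2 / 4) (c := √π)
    (by positivity) (by positivity) ?_
  refine (integrableOn_congr_fun (fun l hl => ?_) measurableSet_Ioi).1 h.integral_prod_right
  simp only [Measure.restrict_univ, hf]
  exact integral_posterior_density_two y hl
end

section
/- Let K ≥ 2 be a natural number, y : Fin K → ℝ with S > 0, and μ ∈ ℝ. Set a = (K−1)/2 and b = (S + K(ȳ − μ)²)/2. Then for every λ > 0, the full conditional density of λ given μ, namely f(μ, λ) / ∫_0^∞ f(μ, t) dt, equals the Inverse-Gamma(a, b) density: f(μ, λ) / ∫_0^∞ f(μ, t) dt = (b^a / Γ(a)) · λ^{−(a+1)} · exp(−b/λ), where Γ is the Gamma function. -/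
open MeasureTheory Real Set

/-- The total mass of the unnormalized inverse-gamma density with shape `a` and scale `b`. -/
lemma integral_rpow_mul_exp_neg_div_Ioi {a b : ℝ} (ha : 0 < a) (hb : 0 < b) :
    ∫ t in Ioi (0 : ℝ), t ^ (-(a + 1)) * Real.exp (-b / t) = Real.Gamma a / b ^ a := by
  have h := integral_comp_rpow_Ioi (fun x : ℝ ↦ x ^ (a - 1) * Real.exp (-(b * x)))
    (p := -1) (by norm_num)
  rw [integral_rpow_mul_exp_neg_mul_Ioi ha hb, one_div, inv_rpow hb.le,
    inv_mul_eq_div] at h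
  rw [← h]
  refine setIntegral_congr_fun measurableSet_Ioi fun t (ht : 0 < t) ↦ ?_
  have hpow : t ^ (-(a + 1)) = t ^ (-1 - 1 : ℝ) * (t ^ (-1 : ℝ)) ^ (a - 1) := by
    rw [← rpow_mul ht.le, ← rpow_add ht]
    ring_nf
  simp only [abs_neg, abs_one, one_mul, smul_eq_mul]
  rw [hpow, rpow_neg_one t, mul_assoc, neg_div, div_eq_mul_inv b t]

/-- The sum of squared deviations from `m` splits into the centered sum of squares and the
squared deviation of the mean. -/
lemma sum_sub_sq_eq_centered_add {K : ℕ} (hK : K ≠ 0) (y : Fin K → ℝ) (m ybar : ℝ)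
    (hybar : ybar = (1 / (K : ℝ)) * ∑ j, y j) :
    ∑ j, (y j - m) ^ 2 = ∑ j, (y j - ybar) ^ 2 + (K : ℝ) * (ybar - m) ^ 2 := by
  have hsum : ∑ j, y j = K * ybar := by
    rw [hybar]
    field_simp
  have hexpand (c : ℝ) : ∑ j, (y j - c) ^ 2 = ∑ j, y j ^ 2 - 2 * c * (K * ybar) + K * c ^ 2 := by
    simp_rw [sub_sq, Finset.sum_add_distrib, Finset.sum_sub_distrib, ← Finset.sum_mul,
      ← Finset.mul_sum, hsum]
    simp
    ring
  rw [hexpand, hexpand]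
  ring

/-- For `K ≥ 2`, `S > 0` and `μ ∈ ℝ`, with `a = (K-1)/2` and
`b = (S + K(ȳ - μ)²)/2`, the full conditional density of `λ` given `μ`, namely
`f(μ, λ) / ∫_0^∞ f(μ, t) dt`, is the Inverse-Gamma(a, b) density. -/
theorem full_conditional_lambda_is_inverse_gamma
    (K : ℕ) (hK : 2 ≤ K) (y : Fin K → ℝ)
    (ybar : ℝ) (hybar : ybar = (1 / (K : ℝ)) * ∑ j, y j)
    (S : ℝ) (hS : S = ∑ j, (y j - ybar) ^ 2) (hSpos : 0 < S)
    (f : ℝ → ℝ → ℝ)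
    (hf : ∀ (μ l : ℝ),
      f μ l = l ^ (-(((K : ℝ) + 1) / 2)) *
        Real.exp (-(1 / (2 * l)) * ∑ j, (y j - μ) ^ 2))
    (μ : ℝ)
    (a b : ℝ) (ha : a = ((K : ℝ) - 1) / 2)
    (hb : b = (S + (K : ℝ) * (ybar - μ) ^ 2) / 2) :
    ∀ l : ℝ, 0 < l →
      f μ l / (∫ t in Set.Ioi (0 : ℝ), f μ t) =
        (b ^ a / Real.Gamma a) * l ^ (-(a + 1)) * Real.exp (-b / l) := by
  have hapos : 0 < a := by
    have : (2 : ℝ) ≤ K := by exact_mod_cast hK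
    rw [ha]
    linarith
  have hbpos : 0 < b := by
    rw [hb]
    positivity
  have hkernel (t : ℝ) : f μ t = t ^ (-(a + 1)) * Real.exp (-b / t) := by
    rw [hf, sum_sub_sq_eq_centered_add (by lia) y μ ybar hybar, ← hS, hb, ha]
    ring_nf
  intro l _
  simp_rw [hkernel]
  rw [integral_rpow_mul_exp_neg_div_Ioi hapos hbpos, div_div_eq_mul_div]
  ring
end

section
/- Let K ≥ 3 be a natural number and y : Fin K → ℝ with S > 0. Then the normalizing constant of the posterior is given explicitly by ∫_0^∞ ∫_ℝ f(μ, λ) dμ dλ = √(2π/K) · Γ((K−2)/2) · (S/2)^{−(K−2)/2}, where Γ is the Gamma function. -/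
open MeasureTheory Real Set

/-- The inverse-gamma integral. -/
lemma integral_rpow_mul_exp_neg_div_Ioi_s5 {a c : ℝ} (ha : 0 < a) (hc : 0 < c) :
    ∫ x in Ioi (0 : ℝ), x ^ (-a - 1) * exp (-(c / x)) = Gamma a * c ^ (-a) := by
  have h := integral_comp_rpow_Ioi (fun t : ℝ => t ^ (a - 1) * exp (-(c * t)))
    (p := -1) (by norm_num)
  rw [integral_rpow_mul_exp_neg_mul_Ioi ha hc] at h
  rw [rpow_neg hc.le, ← inv_rpow hc.le, mul_comm, ← one_div, ← h]
  refine setIntegral_congr_fun measurableSet_Ioi fun x (hx : 0 < x) => ?_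
  simp only [abs_neg, abs_one, one_mul, smul_eq_mul]
  rw [← rpow_mul hx.le, ← mul_assoc, ← rpow_add hx, rpow_neg_one, div_eq_mul_inv]
  ring_nf

/-- Decomposition of a sum of squared deviations around the sample mean. -/
lemma sum_sub_sq_eq_sum_sub_mean_sq_add_s5 {ι : Type*} [Fintype ι] (y : ι → ℝ) {m : ℝ}
    (hm : Fintype.card ι * m = ∑ j, y j) (t : ℝ) :
    ∑ j, (y j - t) ^ 2 = ∑ j, (y j - m) ^ 2 + Fintype.card ι * (t - m) ^ 2 := by
  simp only [sub_sq, Finset.sum_add_distrib, Finset.sum_sub_distrib, ← Finset.sum_mul,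
    ← Finset.mul_sum, Finset.sum_const, Finset.card_univ, nsmul_eq_mul, ← hm]
  ring

/-- For `K ≥ 3` and `S > 0`, the normalizing constant of the
posterior is `∫_0^∞ ∫_ℝ f(μ, λ) dμ dλ = √(2π/K) · Γ((K-2)/2) · (S/2)^{-(K-2)/2}`. -/
theorem posterior_normalizing_constant
    (K : ℕ) (hK : 3 ≤ K) (y : Fin K → ℝ)
    (ybar : ℝ) (hybar : ybar = (1 / (K : ℝ)) * ∑ j, y j)
    (S : ℝ) (hS : S = ∑ j, (y j - ybar) ^ 2) (hSpos : 0 < S)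
    (f : ℝ → ℝ → ℝ)
    (hf : ∀ (μ l : ℝ),
      f μ l = l ^ (-(((K : ℝ) + 1) / 2)) *
        Real.exp (-(1 / (2 * l)) * ∑ j, (y j - μ) ^ 2)) :
    (∫ l in Set.Ioi (0 : ℝ), ∫ μ : ℝ, f μ l) =
      Real.sqrt (2 * Real.pi / (K : ℝ)) * Real.Gamma (((K : ℝ) - 2) / 2) *
        (S / 2) ^ (-(((K : ℝ) - 2) / 2)) := by
  have hK3 : (3 : ℝ) ≤ K := by exact_mod_cast hK
  have hK0 : (0 : ℝ) < K := by linarith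
  have hmean : (Fintype.card (Fin K) : ℝ) * ybar = ∑ j, y j := by
    rw [hybar, Fintype.card_fin]
    field_simp
  rw [mul_assoc, ← integral_rpow_mul_exp_neg_div_Ioi_s5 (by linarith) (half_pos hSpos),
    ← integral_const_mul]
  refine setIntegral_congr_fun measurableSet_Ioi fun l (hl : 0 < l) => ?_
  have hfac (μ : ℝ) : f μ l = l ^ (-(((K : ℝ) + 1) / 2)) * exp (-(S / 2 / l)) *
      exp (-(K / (2 * l)) * (μ - ybar) ^ 2) := by
    rw [hf, sum_sub_sq_eq_sum_sub_mean_sq_add_s5 y hmean, ← hS, Fintype.card_fin, mul_assoc,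
      ← exp_add]
    congr 2
    field_simp
    ring
  have hsqrt : √(π / (K / (2 * l))) = √(2 * π / K) * l ^ (1 / 2 : ℝ) := by
    rw [← sqrt_eq_rpow, ← sqrt_mul (by positivity)]
    congr 1
    field_simp
  simp only [hfac]
  rw [integral_const_mul,
    integral_sub_right_eq_self (fun μ : ℝ => exp (-(K / (2 * l)) * μ ^ 2)) ybar,
    integral_gaussian, hsqrt]
  have hpow : l ^ (-(((K : ℝ) - 2) / 2) - 1) =
      l ^ (-(((K : ℝ) + 1) / 2)) * l ^ (1 / 2 : ℝ) := by
    rw [← rpow_add hl]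
    ring_nf
  rw [hpow]
  ring
end

section
/- Let K ≥ 4 be a natural number and y : Fin K → ℝ with S > 0. Then the function (μ, λ) ↦ μ · f(μ, λ) is integrable over ℝ × (0, ∞), and the posterior mean of μ equals the sample mean: (∫_0^∞ ∫_ℝ μ f(μ, λ) dμ dλ) / (∫_0^∞ ∫_ℝ f(μ, λ) dμ dλ) = ȳ, i.e. E(μ | y) = ȳ. -/
open MeasureTheory Real Set

lemma integrableOn_Ioi_rpow_neg_mul_exp_neg_div {a b : ℝ} (ha : 1 < a) (hb : 0 < b) :
    IntegrableOn (fun l : ℝ => l ^ (-a) * exp (-(b / l))) (Ioi 0) := by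
  have h := integrableOn_rpow_mul_exp_neg_mul_rpow (p := 1) (s := a - 2) (b := b)
    (by linarith) one_pos hb
  refine ((integrableOn_Ioi_comp_rpow_iff' _ (p := -1) (by norm_num)).mpr h).congr_fun
    (fun l hl => ?_) measurableSet_Ioi
  have hl : 0 < l := hl
  simp only [smul_eq_mul, rpow_one]
  rw [← mul_assoc, ← rpow_mul hl.le, ← rpow_add hl, rpow_neg_one]
  ring_nf

lemma integrable_pow_mul_exp_neg_mul_sq (n : ℕ) {b : ℝ} (hb : 0 < b) :
    Integrable (fun x : ℝ => x ^ n * exp (-b * x ^ 2)) := by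
  simpa only [rpow_natCast] using
    integrable_rpow_mul_exp_neg_mul_sq hb (s := n) (by linarith [n.cast_nonneg (α := ℝ)])

lemma integral_abs_pow_mul_exp_neg_mul_sq (n : ℕ) {b : ℝ} (hb : 0 < b) :
    ∫ x : ℝ, |x| ^ n * exp (-b * x ^ 2) =
      b ^ (-(((n : ℝ) + 1) / 2)) * Gamma (((n : ℝ) + 1) / 2) := by
  have h := integral_rpow_mul_exp_neg_mul_rpow (p := 2) (q := n) (b := b) two_pos
    (by linarith [n.cast_nonneg (α := ℝ)]) hb
  have h' := integral_comp_abs (f := fun x : ℝ => x ^ n * exp (-b * x ^ 2))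
  simp only [sq_abs] at h'
  simp only [rpow_natCast, rpow_two] at h
  rw [h', h]
  ring_nf

/-- The unnormalized density of a normal-inverse-gamma law, times the `n`-th power of the
centered first coordinate, is integrable as soon as the power of the scale is large enough. -/
lemma integrable_pow_mul_normalInverseGamma (n : ℕ) {p b c : ℝ} (m : ℝ)
    (hp : ((n : ℝ) + 1) / 2 + 1 < p) (hb : 0 < b) (hc : 0 < c) :
    Integrable (fun z : ℝ × ℝ => (z.1 - m) ^ n *
      (z.2 ^ (-p) * exp (-(b / z.2)) * exp (-(c / z.2) * (z.1 - m) ^ 2)))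
      (volume.prod (volume.restrict (Ioi 0))) := by
  have hmeas : Measurable (fun z : ℝ × ℝ => (z.1 - m) ^ n *
      (z.2 ^ (-p) * exp (-(b / z.2)) * exp (-(c / z.2) * (z.1 - m) ^ 2))) := by
    fun_prop
  rw [integrable_prod_iff' hmeas.aestronglyMeasurable]
  constructor
  · filter_upwards [ae_restrict_mem measurableSet_Ioi] with l (hl : 0 < l)
    refine (((integrable_pow_mul_exp_neg_mul_sq n (div_pos hc hl)).comp_sub_right m).const_mul
      (l ^ (-p) * exp (-(b / l)))).congr (.of_forall fun x => ?_)
    ring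
  · have h := (integrableOn_Ioi_rpow_neg_mul_exp_neg_div (a := p - ((n : ℝ) + 1) / 2)
      (by linarith) hb).const_mul (c ^ (-(((n : ℝ) + 1) / 2)) * Gamma (((n : ℝ) + 1) / 2))
    refine IntegrableOn.congr_fun h (fun l hl => ?_) measurableSet_Ioi
    have hl : 0 < l := hl
    have hnorm : ∀ x : ℝ, ‖(x - m) ^ n *
        (l ^ (-p) * exp (-(b / l)) * exp (-(c / l) * (x - m) ^ 2))‖ =
        l ^ (-p) * exp (-(b / l)) * (|x - m| ^ n * exp (-(c / l) * (x - m) ^ 2)) := fun x => by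
      rw [norm_mul, norm_pow, norm_eq_abs, norm_of_nonneg (by positivity)]
      ring
    simp only [hnorm]
    rw [integral_const_mul,
      integral_sub_right_eq_self (fun x : ℝ => |x| ^ n * exp (-(c / l) * x ^ 2)) m,
      integral_abs_pow_mul_exp_neg_mul_sq n (div_pos hc hl), div_rpow hc.le hl.le,
      show -(p - ((n : ℝ) + 1) / 2) = -p - -(((n : ℝ) + 1) / 2) by ring, rpow_sub hl]
    ring

lemma integral_id_mul_exp_neg_mul_sq (b : ℝ) : ∫ x : ℝ, x * exp (-b * x ^ 2) = 0 := by
  have h := integral_neg_eq_self (fun x : ℝ => x * exp (-b * x ^ 2)) volume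
  simp only [neg_sq, neg_mul, integral_neg] at h ⊢
  linarith

lemma sum_sub_sq_eq_sum_sub_mean_sq {K : ℕ} (hK : K ≠ 0) (y : Fin K → ℝ) (x : ℝ) {m : ℝ}
    (hm : m = (1 / (K : ℝ)) * ∑ j, y j) :
    ∑ j, (y j - x) ^ 2 = ∑ j, (y j - m) ^ 2 + K * (x - m) ^ 2 := by
  have hK' : (K : ℝ) ≠ 0 := Nat.cast_ne_zero.mpr hK
  have hsum : ∑ j, y j = K * m := by rw [hm]; field_simp
  have hdev : ∑ j, (y j - m) = 0 := by simp [Finset.sum_sub_distrib, hsum]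
  calc ∑ j, (y j - x) ^ 2
      = ∑ j, ((y j - m) ^ 2 + (-2 * (x - m) * (y j - m) + (x - m) ^ 2)) :=
        Finset.sum_congr rfl fun j _ => by ring
    _ = _ := by
        rw [Finset.sum_add_distrib, Finset.sum_add_distrib, ← Finset.mul_sum, hdev]
        simp

/-- For `K ≥ 4` and `S > 0`, the function `(μ, λ) ↦ μ · f(μ, λ)` is
integrable over `ℝ × (0, ∞)`, and the posterior mean of `μ` equals the sample
mean: `E(μ | y) = ȳ`. -/
theorem posterior_mean_mu_eq_sample_mean
    (K : ℕ) (hK : 4 ≤ K) (y : Fin K → ℝ)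
    (ybar : ℝ) (hybar : ybar = (1 / (K : ℝ)) * ∑ j, y j)
    (S : ℝ) (hS : S = ∑ j, (y j - ybar) ^ 2) (hSpos : 0 < S)
    (f : ℝ → ℝ → ℝ)
    (hf : ∀ (μ l : ℝ),
      f μ l = l ^ (-(((K : ℝ) + 1) / 2)) *
        Real.exp (-(1 / (2 * l)) * ∑ j, (y j - μ) ^ 2)) :
    IntegrableOn (fun p : ℝ × ℝ => p.1 * f p.1 p.2)
      ((Set.univ : Set ℝ) ×ˢ Set.Ioi (0 : ℝ)) ∧
    (∫ l in Set.Ioi (0 : ℝ), ∫ μ : ℝ, μ * f μ l) /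
      (∫ l in Set.Ioi (0 : ℝ), ∫ μ : ℝ, f μ l) = ybar := by
  have hK4 : (4 : ℝ) ≤ K := by exact_mod_cast hK
  have hc : 0 < (K : ℝ) / 2 := by linarith
  have hb : 0 < S / 2 := half_pos hSpos
  have hf' : ∀ μ l : ℝ, f μ l = l ^ (-(((K : ℝ) + 1) / 2)) * exp (-(S / 2 / l)) *
      exp (-((K : ℝ) / 2 / l) * (μ - ybar) ^ 2) := fun μ l => by
    rw [hf, sum_sub_sq_eq_sum_sub_mean_sq (by lia) y μ hybar, ← hS, mul_assoc, ← exp_add]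
    ring_nf
  have hI0 : Integrable (fun z : ℝ × ℝ => f z.1 z.2) (volume.prod (volume.restrict (Ioi 0))) := by
    simpa only [hf', pow_zero, one_mul] using integrable_pow_mul_normalInverseGamma 0 ybar
      (p := ((K : ℝ) + 1) / 2) (by push_cast; linarith) hb hc
  have hI1 : Integrable (fun z : ℝ × ℝ => (z.1 - ybar) * f z.1 z.2)
      (volume.prod (volume.restrict (Ioi 0))) := by
    simpa only [hf', pow_one] using integrable_pow_mul_normalInverseGamma 1 ybar
      (p := ((K : ℝ) + 1) / 2) (by push_cast; linarith) hb hc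
  constructor
  · rw [IntegrableOn, Measure.volume_eq_prod, ← Measure.prod_restrict, Measure.restrict_univ]
    refine (hI1.add (hI0.const_mul ybar)).congr (.of_forall fun z => ?_)
    simp only [Pi.add_apply]
    ring
  have hfib : ∀ l ∈ Ioi (0 : ℝ), ∫ μ : ℝ, μ * f μ l = ybar * ∫ μ : ℝ, f μ l := fun l hl => by
    have hcl : 0 < (K : ℝ) / 2 / l := div_pos hc hl
    have h0 : Integrable (fun μ : ℝ => f μ l) := by
      simp only [hf']
      exact ((integrable_exp_neg_mul_sq hcl).comp_sub_right ybar).const_mul _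
    have hsplit : ∀ μ : ℝ, μ * f μ l = l ^ (-(((K : ℝ) + 1) / 2)) * exp (-(S / 2 / l)) *
        ((μ - ybar) * exp (-((K : ℝ) / 2 / l) * (μ - ybar) ^ 2)) + ybar * f μ l := fun μ => by
      rw [hf']
      ring
    simp only [hsplit]
    rw [integral_add (((integrable_mul_exp_neg_mul_sq hcl).comp_sub_right ybar).const_mul _)
        (h0.const_mul _), integral_const_mul, integral_const_mul,
      integral_sub_right_eq_self (fun x : ℝ => x * exp (-((K : ℝ) / 2 / l) * x ^ 2)) ybar,
      integral_id_mul_exp_neg_mul_sq, mul_zero, zero_add]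
  have hfib_pos : ∀ l ∈ Ioi (0 : ℝ), 0 < ∫ μ : ℝ, f μ l := fun l hl => by
    have hl : 0 < l := hl
    simp only [hf']
    rw [integral_const_mul,
      integral_sub_right_eq_self (fun x : ℝ => exp (-((K : ℝ) / 2 / l) * x ^ 2)) ybar,
      integral_gaussian]
    positivity
  have hpos : 0 < ∫ l in Ioi (0 : ℝ), ∫ μ : ℝ, f μ l := by
    rw [setIntegral_pos_iff_support_of_nonneg_ae
      ((ae_restrict_mem measurableSet_Ioi).mono fun l hl => (hfib_pos l hl).le)
      hI0.integral_prod_right,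
      inter_eq_self_of_subset_right
        fun l hl => Function.mem_support.mpr (hfib_pos l hl).ne']
    simp
  rw [setIntegral_congr_fun measurableSet_Ioi hfib, integral_const_mul,
    mul_div_cancel_right₀ _ hpos.ne']
end

section
/- Let K ≥ 3 be a natural number, y : Fin K → ℝ with S > 0, and let p be a real number with p ≥ (K−2)/2. Then the function (μ, λ) ↦ λ^p · f(μ, λ) is NOT integrable over ℝ × (0, ∞); in particular, for K = 3 and K = 4 the posterior mean of λ does not exist. -/
open MeasureTheory Real Set

lemma sum_sq_sub_le {ι : Type*} [Fintype ι] (y : ι → ℝ) {m l : ℝ} (hl : 1 ≤ l)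
    (hm : m ^ 2 ≤ l) : ∑ j, (y j - m) ^ 2 ≤ (∑ j, 2 * ((y j) ^ 2 + 1)) * l := by
  rw [Finset.sum_mul]
  refine Finset.sum_le_sum fun j _ => ?_
  nlinarith [sq_nonneg (y j + m), mul_le_mul_of_nonneg_left hl (sq_nonneg (y j))]

/-- A nonnegative function that dominates `c * l ^ (-3/2)` on the region `0 < m ≤ √l`, `1 < l`
is not integrable there, since each section `l` carries mass at least `c / l`. -/
lemma not_integrableOn_of_le_below_sqrt {g : ℝ × ℝ → ℝ} {c : ℝ} (hc : 0 < c)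
    (hg : ∀ m l, 1 < l → 0 ≤ g (m, l))
    (hle : ∀ m l, 1 < l → m ∈ Ioc 0 (√l) → c * l ^ (-(3 / 2) : ℝ) ≤ g (m, l)) :
    ¬ IntegrableOn g ((Set.univ : Set ℝ) ×ˢ Ioi (1 : ℝ)) := by
  intro h
  rw [IntegrableOn, Measure.volume_eq_prod, ← Measure.prod_restrict, Measure.restrict_univ] at h
  have hint : IntegrableOn (fun l : ℝ => c * l⁻¹) (Ioi 1) := by
    refine Integrable.mono' h.integral_prod_right (by fun_prop) ?_
    filter_upwards [h.prod_left_ae, ae_restrict_mem measurableSet_Ioi] with l hl hl1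
    have hl0 : (0 : ℝ) < l := zero_lt_one.trans hl1
    rw [Real.norm_of_nonneg (by positivity)]
    calc c * l⁻¹ = ∫ _ in Ioc 0 (√l), c * l ^ (-(3 / 2) : ℝ) := by
          rw [setIntegral_const, Measure.real, Real.volume_Ioc, sub_zero,
            ENNReal.toReal_ofReal (sqrt_nonneg l), smul_eq_mul, mul_left_comm, Real.sqrt_eq_rpow,
            ← Real.rpow_add hl0, ← Real.rpow_neg_one]
          norm_num
      _ ≤ ∫ m in Ioc 0 (√l), g (m, l) :=
          setIntegral_mono_on (integrableOn_const (by simp)) hl.integrableOn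
            measurableSet_Ioc fun m hm => hle m l hl1 hm
      _ ≤ ∫ m, g (m, l) :=
          setIntegral_le_integral hl (Filter.Eventually.of_forall fun m => hg m l hl1)
  refine not_integrableOn_Ioi_inv (a := 1) ?_
  simpa [IntegrableOn, hc.ne'] using hint.const_mul c⁻¹

/-- For `K ≥ 3`, `S > 0` and `p ≥ (K-2)/2`, the function
`(μ, λ) ↦ λ^p · f(μ, λ)` is NOT integrable over `ℝ × (0, ∞)`; in particular,
for `K = 3` and `K = 4` the posterior mean of `λ` does not exist. -/
theorem posterior_moment_lambda_not_integrable
    (K : ℕ) (hK : 3 ≤ K) (y : Fin K → ℝ)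
    (ybar : ℝ) (hybar : ybar = (1 / (K : ℝ)) * ∑ j, y j)
    (S : ℝ) (hS : S = ∑ j, (y j - ybar) ^ 2) (hSpos : 0 < S)
    (f : ℝ → ℝ → ℝ)
    (hf : ∀ (μ l : ℝ),
      f μ l = l ^ (-(((K : ℝ) + 1) / 2)) *
        Real.exp (-(1 / (2 * l)) * ∑ j, (y j - μ) ^ 2))
    (p : ℝ) (hp : ((K : ℝ) - 2) / 2 ≤ p) :
    ¬ IntegrableOn (fun q : ℝ × ℝ => q.2 ^ p * f q.1 q.2)
      ((Set.univ : Set ℝ) ×ˢ Set.Ioi (0 : ℝ)) := by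
  intro h
  set A : ℝ := ∑ j, 2 * ((y j) ^ 2 + 1)
  refine not_integrableOn_of_le_below_sqrt (c := Real.exp (-(A / 2))) (Real.exp_pos _)
    ?_ ?_ (h.mono_set (prod_mono_right (Ioi_subset_Ioi zero_le_one)))
  · intro m l hl
    have hl0 : (0 : ℝ) < l := zero_lt_one.trans hl
    simp only [hf]
    positivity
  · intro m l hl hm
    have hl0 : (0 : ℝ) < l := zero_lt_one.trans hl
    have hQ : ∑ j, (y j - m) ^ 2 ≤ A * l :=
      sum_sq_sub_le y hl.le ((Real.le_sqrt hm.1.le hl0.le).1 hm.2)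
    simp only [hf]
    rw [← mul_assoc, ← Real.rpow_add hl0, mul_comm]
    gcongr
    · exact hl.le
    · linarith
    · have hA : A / 2 = 1 / (2 * l) * (A * l) := by field_simp
      rw [hA, neg_mul, neg_le_neg_iff]
      gcongr
end
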